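/- Let U ⊂ ℝⁿ be a bounded open set, λ ∈ (0,1], σ ∈ (0,1], and δ > 0. Let Λ_ε ⊆ U be relatively closed with dist(Λ_ε, ∂U) ≥ δ, and let w_ε : U → ℝ be continuous with w_ε ≥ −σ² in U, w_ε ≤ 0 on Λ_ε, and Δw_ε ≥ λ weakly in U ∖ Λ_ε. Let w₀ : U → ℝ be continuous with w₀ ≥ 0, set Λ₀ := {x ∈ U : w₀(x) = 0} and Γ₀ := ∂Λ₀ ∩ U, assume Λ₀ is nonempty with dist(Λ₀, ∂U) ≥ δ, and assume: (sandwich) w₀ − σ² ≤ w_ε ≤ w₀ in U; (strong non-degeneracy) there is c₁ > 0 with w₀(x) ≥ c₁ dist(x, Γ₀)² whenever w₀(x) > 0; (non-degeneracy) there is c₀ > 0 with sup_{B_r(x)} w₀ ≥ c₀ r² whenever x ∈ Γ₀ and cl(B_r(x)) ⊆ U; (positive density) there is c₂ ∈ (0,1/2) such that for every x ∈ Λ₀ and r > 0 with B_r(x) ⊆ U there is y ∈ Λ₀ ∩ B_r(x) with cl(B_{c₂ r}(y)) ⊆ Λ₀ ∩ B_r(x); (gradient bound) w₀ is differentiable with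 |∇w₀(y)| ≤ M dist(y, Λ₀) for all y ∈ U. Let L := 4(2n/λ)^{1/2}σ, let Λ̃_ε be the union of all closed cubes L(k + [0,1]ⁿ), k ∈ ℤⁿ, intersecting Λ_ε, and Γ̃_ε := ∂Λ̃_ε ∩ U. Then there exists C ≥ 1 depending only on n, λ, c₀, c₁, c₂, M, δ and diam(U) such that d_H(Λ₀, Λ̃_ε) ≤ C σ and d_H(Γ₀, Γ̃_ε) ≤ C σ. -/

import Mathlib

open MeasureTheory Metric Set Bornology

/-- The (pointwise) Laplacian of a smooth `f : ℝⁿ → ℝ`. -/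
noncomputable def lapl (n : ℕ) (f : EuclideanSpace ℝ (Fin n) → ℝ)
    (x : EuclideanSpace ℝ (Fin n)) : ℝ :=
  ∑ i : Fin n, fderiv ℝ (fun y => fderiv ℝ f y (EuclideanSpace.single i 1)) x
    (EuclideanSpace.single i 1)

/-- `Δw ≥ c` weakly in `V`. -/
def LapGeWeak (n : ℕ) (V : Set (EuclideanSpace ℝ (Fin n)))
    (w : EuclideanSpace ℝ (Fin n) → ℝ) (c : ℝ) : Prop :=
  ∀ φ : EuclideanSpace ℝ (Fin n) → ℝ, ContDiff ℝ (⊤ : ℕ∞) φ → HasCompactSupport φ →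
    tsupport φ ⊆ V → (∀ x, 0 ≤ φ x) →
    c * ∫ x in V, φ x ≤ ∫ x in V, w x * lapl n φ x

/-- The closed lattice cube `L(k + [0,1]ⁿ)` for `k ∈ ℤⁿ`. -/
def latticeCube (n : ℕ) (L : ℝ) (k : Fin n → ℤ) : Set (EuclideanSpace ℝ (Fin n)) :=
  {x | ∀ i, L * (k i : ℝ) ≤ x i ∧ x i ≤ L * (k i : ℝ) + L}

/-- The bulk set: the union of all closed lattice cubes of side `L` meeting `Λ`. -/
def bulkSet (n : ℕ) (L : ℝ) (Λ : Set (EuclideanSpace ℝ (Fin n))) :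
    Set (EuclideanSpace ℝ (Fin n)) :=
  ⋃ (k : Fin n → ℤ) (_ : (latticeCube n L k ∩ Λ).Nonempty), latticeCube n L k

lemma lapl_comp_const_sub {n : ℕ} {φ : EuclideanSpace ℝ (Fin n) → ℝ}
    (x t : EuclideanSpace ℝ (Fin n)) :
    lapl n (fun s => φ (x - s)) t = lapl n φ (x - t) := by
  have h : ∀ (ψ : EuclideanSpace ℝ (Fin n) → ℝ) (s e : EuclideanSpace ℝ (Fin n)),
      fderiv ℝ (fun s => ψ (x - s)) s e = -fderiv ℝ ψ (x - s) e := by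
    intro ψ s e
    have h1 : (fun s => ψ (x - s)) =
        (fun z => ψ (x + z)) ∘ ContinuousLinearEquiv.neg ℝ (M := EuclideanSpace ℝ (Fin n)) := by
      funext s; simp [sub_eq_add_neg]
    rw [h1, ContinuousLinearEquiv.comp_right_fderiv, fderiv_comp_add_left]
    simp [sub_eq_add_neg]
  unfold lapl
  refine Finset.sum_congr rfl fun i _ => ?_
  simp_rw [h φ]
  have h2 := h (fun y => -fderiv ℝ φ y (EuclideanSpace.single i 1)) t (EuclideanSpace.single i 1)
  rw [h2, fderiv_fun_neg]
  simp

lemma lapl_eq_zero_of_notMem_tsupport {n : ℕ} {φ : EuclideanSpace ℝ (Fin n) → ℝ}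
    {x : EuclideanSpace ℝ (Fin n)} (hx : x ∉ tsupport φ) : lapl n φ x = 0 := by
  unfold lapl
  refine Finset.sum_eq_zero fun i _ => ?_
  have h1 : φ =ᶠ[nhds x] fun _ => 0 := notMem_tsupport_iff_eventuallyEq.mp hx
  have h2 : (fun y => fderiv ℝ φ y (EuclideanSpace.single i 1)) =ᶠ[nhds x] fun _ => 0 := by
    filter_upwards [h1.fderiv (𝕜 := ℝ)] with y hy
    simp [hy]
  rw [h2.fderiv_eq]
  simp

lemma fderiv_convolution_apply {n : ℕ} {f φ : EuclideanSpace ℝ (Fin n) → ℝ}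
    (hf : LocallyIntegrable f) (hφ : ContDiff ℝ (⊤ : ℕ∞) φ) (hc : HasCompactSupport φ)
    (x e : EuclideanSpace ℝ (Fin n)) :
    fderiv ℝ (convolution f φ (ContinuousLinearMap.lsmul ℝ ℝ) volume) x e =
      convolution f (fun a => fderiv ℝ φ a e) (ContinuousLinearMap.lsmul ℝ ℝ) volume x := by
  have h1 : ContDiff ℝ 1 φ := hφ.of_le (by exact_mod_cast le_top)
  rw [(hc.hasFDerivAt_convolution_right (ContinuousLinearMap.lsmul ℝ ℝ) hf h1 x).fderiv,
    convolution_precompR_apply _ hf (hc.fderiv ℝ) (h1.continuous_fderiv one_ne_zero)]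

lemma contDiff_fderiv_apply_const {n : ℕ} {φ : EuclideanSpace ℝ (Fin n) → ℝ}
    (hφ : ContDiff ℝ (⊤ : ℕ∞) φ) (e : EuclideanSpace ℝ (Fin n)) :
    ContDiff ℝ (⊤ : ℕ∞) (fun a => fderiv ℝ φ a e) :=
  (hφ.fderiv_right (m := (⊤ : ℕ∞)) (by simp)).clm_apply contDiff_const

lemma lapl_convolution {n : ℕ} {f φ : EuclideanSpace ℝ (Fin n) → ℝ}
    (hf : LocallyIntegrable f) (hφ : ContDiff ℝ (⊤ : ℕ∞) φ) (hc : HasCompactSupport φ)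
    (x : EuclideanSpace ℝ (Fin n)) :
    lapl n (convolution f φ (ContinuousLinearMap.lsmul ℝ ℝ) volume) x =
      ∫ t, f t * lapl n φ (x - t) := by
  have hD : ∀ e : EuclideanSpace ℝ (Fin n), ContDiff ℝ (⊤ : ℕ∞) (fun a => fderiv ℝ φ a e) :=
    contDiff_fderiv_apply_const hφ
  have hDc : ∀ e : EuclideanSpace ℝ (Fin n), HasCompactSupport (fun a => fderiv ℝ φ a e) :=
    fun e => hc.fderiv_apply ℝ e
  unfold lapl
  simp_rw [fderiv_convolution_apply hf hφ hc]
  have h2 : ∀ i : Fin n, fderiv ℝ (fun y => convolution f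
        (fun a => fderiv ℝ φ a (EuclideanSpace.single i 1))
        (ContinuousLinearMap.lsmul ℝ ℝ) volume y) x (EuclideanSpace.single i 1) =
      ∫ t, f t * fderiv ℝ (fun a => fderiv ℝ φ a (EuclideanSpace.single i 1)) (x - t)
        (EuclideanSpace.single i 1) := by
    intro i
    exact fderiv_convolution_apply hf (hD _) (hDc _) x _
  simp_rw [h2, Finset.mul_sum]
  rw [integral_finsetSum]
  intro i _
  exact ((hDc _).fderiv_apply ℝ (EuclideanSpace.single i 1)).convolutionExists_right
    (ContinuousLinearMap.lsmul ℝ ℝ) hf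
    (contDiff_fderiv_apply_const (hD _) _).continuous x

/-- At a local maximum of `F - a|· - y|²` the Laplacian of `F` is at most `2na`. -/
lemma lapl_le_of_isLocalMax {n : ℕ} {F : EuclideanSpace ℝ (Fin n) → ℝ}
    (hF : ContDiff ℝ (⊤ : ℕ∞) F) (a : ℝ) (x y : EuclideanSpace ℝ (Fin n))
    (h : IsLocalMax (fun z => F z - a * ‖z - y‖ ^ 2) x) : lapl n F x ≤ 2 * n * a := by
  have key : ∀ i : Fin n, fderiv ℝ (fun y => fderiv ℝ F y (EuclideanSpace.single i 1)) x
      (EuclideanSpace.single i 1) ≤ 2 * a := by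
    intro i
    set e : EuclideanSpace ℝ (Fin n) := EuclideanSpace.single i 1 with he
    have hen : ‖e‖ = 1 := by simp [he]
    set g : ℝ → ℝ := fun t => F (x + t • e) - a * ‖x + t • e - y‖ ^ 2 with hg
    set c : ℝ := inner ℝ (x - y) e with hcdef
    have hq : ∀ t : ℝ, ‖x + t • e - y‖ ^ 2 = ‖x - y‖ ^ 2 + 2 * t * c + t ^ 2 := by
      intro t
      have : x + t • e - y = (x - y) + t • e := by abel
      rw [this, norm_add_sq_real, inner_smul_right, norm_smul, hen]
      simp [← hcdef]; ring
    have hline : ∀ t : ℝ, HasDerivAt (fun t : ℝ => x + t • e) e t := by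
      intro t
      simpa using ((hasDerivAt_id t).smul_const e).const_add x
    have hd : ∀ t, HasDerivAt g (fderiv ℝ F (x + t • e) e - a * (2 * c + 2 * t)) t := by
      intro t
      have h1 : HasDerivAt (fun t : ℝ => F (x + t • e)) (fderiv ℝ F (x + t • e) e) t :=
        ((hF.differentiable (by simp)) _).hasFDerivAt.comp_hasDerivAt t (hline t)
      have h2 : HasDerivAt (fun t : ℝ => ‖x - y‖ ^ 2 + 2 * t * c + t ^ 2) (2 * c + 2 * t) t := by
        have h3 := (((hasDerivAt_id t).const_mul 2).mul_const c).const_add (‖x - y‖ ^ 2)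
        have h4 := h3.add ((hasDerivAt_id t).pow 2)
        exact h4.congr_deriv (by simp)
      have h5 := h1.sub (h2.const_mul a)
      simp only [hg, hq]
      exact h5
    have hdg : deriv g = fun t => fderiv ℝ F (x + t • e) e - a * (2 * c + 2 * t) :=
      funext fun t => (hd t).deriv
    have hdd : HasDerivAt (deriv g) (fderiv ℝ (fun y => fderiv ℝ F y e) x e - 2 * a) 0 := by
      rw [hdg]
      have h0 : x + (0 : ℝ) • e = x := by simp
      have h1 : HasDerivAt (fun t : ℝ => fderiv ℝ F (x + t • e) e)
          (fderiv ℝ (fun y => fderiv ℝ F y e) (x + (0 : ℝ) • e) e) 0 :=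
        (((contDiff_fderiv_apply_const hF e).differentiable (by simp)) _).hasFDerivAt.comp_hasDerivAt
          (0 : ℝ) (hline 0)
      rw [h0] at h1
      have h2 : HasDerivAt (fun t : ℝ => a * (2 * c + 2 * t)) (2 * a) 0 := by
        exact ((((hasDerivAt_id (0 : ℝ)).const_mul 2).const_add (2 * c)).const_mul a).congr_deriv
          (by ring)
      exact h1.sub h2
    have hmax : IsLocalMax g 0 := by
      have hcont : ContinuousAt (fun t : ℝ => x + t • e) 0 := (hline 0).continuousAt
      have ht : Filter.Tendsto (fun t : ℝ => x + t • e) (nhds 0) (nhds x) := by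
        simpa [ContinuousAt] using hcont
      have := ht.eventually h
      simpa [IsLocalMax, IsMaxFilter, hg] using this
    by_contra hpos
    push Not at hpos
    have hmin : IsLocalMin g 0 := by
      refine isLocalMin_of_deriv_deriv_pos ?_ hmax.deriv_eq_zero (hd 0).continuousAt
      rw [hdd.deriv]; linarith
    have hconst : g =ᶠ[nhds 0] fun _ => g 0 := by
      filter_upwards [hmax, hmin] with t h1 h2 using le_antisymm h1 h2
    have h1 : deriv g =ᶠ[nhds 0] fun _ => 0 := by
      filter_upwards [hconst.deriv] with t ht
      simpa using ht
    have h2 := h1.deriv_eq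
    rw [hdd.deriv] at h2
    simp at h2
    linarith
  calc lapl n F x ≤ ∑ _i : Fin n, 2 * a := Finset.sum_le_sum fun i _ => key i
    _ = 2 * n * a := by simp; ring

/-- A function with values in `[-s, 0]` on a ball on which it satisfies `Δw ≥ lam` weakly forces
the ball to be small. -/
lemma LapGeWeak.mul_sq_radius_le {n : ℕ} (hn : 0 < n) {V : Set (EuclideanSpace ℝ (Fin n))}
    {w : EuclideanSpace ℝ (Fin n) → ℝ} {lam : ℝ} (hw : LapGeWeak n V w lam)
    {y : EuclideanSpace ℝ (Fin n)} {ρ s : ℝ} (hρ : 0 < ρ) (hV : closedBall y ρ ⊆ V)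
    (hc : ContinuousOn w (closedBall y ρ)) (hlow : ∀ x ∈ closedBall y ρ, -s ≤ w x)
    (hup : ∀ x ∈ closedBall y ρ, w x ≤ 0) : lam * ρ ^ 2 ≤ 2 * n * s := by
  by_contra hcon
  push Not at hcon
  have hy : y ∈ closedBall y ρ := mem_closedBall_self hρ.le
  have hs : 0 ≤ s := by linarith [hlow y hy, hup y hy]
  have hn' : (0 : ℝ) < n := by exact_mod_cast hn
  obtain ⟨r, hr, hr0, hrρ⟩ : ∃ r : ℝ, 2 * n * s < lam * r ^ 2 ∧ 0 < r ∧ r < ρ := by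
    have hcont : Continuous fun r : ℝ => lam * r ^ 2 := by fun_prop
    have h1 : ∀ᶠ r in nhdsWithin ρ (Iio ρ), 2 * n * s < lam * r ^ 2 :=
      nhdsWithin_le_nhds (hcont.continuousAt.eventually (lt_mem_nhds hcon))
    have h2 : ∀ᶠ r in nhdsWithin ρ (Iio ρ), r ∈ Ioo 0 ρ := Ioo_mem_nhdsLT hρ
    obtain ⟨r, h1, h2⟩ := (h1.and h2).exists
    exact ⟨r, h1, h2.1, h2.2⟩
  obtain ⟨a, ha1, ha2⟩ : ∃ a : ℝ, s / r ^ 2 < a ∧ a < lam / (2 * n) := by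
    refine exists_between ?_
    rw [div_lt_div_iff₀ (by positivity) (by positivity)]
    linarith
  rw [div_lt_iff₀ (by positivity)] at ha1
  rw [lt_div_iff₀ (by positivity)] at ha2
  set g : EuclideanSpace ℝ (Fin n) → ℝ := (closedBall y ρ).indicator w with hg
  have hgloc : LocallyIntegrable g :=
    ((hc.integrableOn_compact (isCompact_closedBall y ρ)).integrable_indicator
      measurableSet_closedBall).locallyIntegrable
  have hgle : ∀ t, g t ≤ 0 := fun t => indicator_apply_le' (fun h => hup t h) (fun _ => le_rfl)
  have hgge : ∀ t, -s ≤ g t := by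
    intro t
    by_cases h : t ∈ closedBall y ρ
    · simpa [hg, indicator_of_mem h] using hlow t h
    · simpa [hg, indicator_of_notMem h] using hs
  let b : ContDiffBump (0 : EuclideanSpace ℝ (Fin n)) :=
    ⟨(ρ - r) / 2, ρ - r, by linarith, by linarith⟩
  set φ : EuclideanSpace ℝ (Fin n) → ℝ := b.normed volume with hφdef
  have hφ : ContDiff ℝ (⊤ : ℕ∞) φ := b.contDiff_normed
  have hφc : HasCompactSupport φ := b.hasCompactSupport_normed
  have hφ0 : ∀ x, 0 ≤ φ x := b.nonneg_normed
  have hφt : tsupport φ = closedBall 0 (ρ - r) := b.tsupport_normed_eq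
  have hφ1 : ∀ x, ∫ t, φ (x - t) = 1 := fun x => by
    rw [integral_sub_left_eq_self φ volume x]; exact b.integral_normed
  set F := convolution g φ (ContinuousLinearMap.lsmul ℝ ℝ) volume with hF
  have hFx : ∀ x, F x = ∫ t, g t * φ (x - t) := fun x => rfl
  have hFsmooth : ContDiff ℝ (⊤ : ℕ∞) F := hφc.contDiff_convolution_right _ hgloc hφ
  have hint : ∀ x, Integrable fun t => φ (x - t) := fun x =>
    ((hφ.continuous.integrable_of_hasCompactSupport hφc).comp_sub_left x)
  have hFle : ∀ x, F x ≤ 0 := fun x => by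
    rw [hFx]
    exact integral_nonpos fun t => mul_nonpos_of_nonpos_of_nonneg (hgle t) (hφ0 _)
  have hFge : ∀ x, -s ≤ F x := fun x => by
    have h1 : -s = ∫ t, -s * φ (x - t) := by rw [integral_const_mul, hφ1]; ring
    rw [hFx, h1]
    refine integral_mono ((hint x).const_mul _) ?_
      fun t => mul_le_mul_of_nonneg_right (hgge t) (hφ0 _)
    exact hφc.convolutionExists_right (ContinuousLinearMap.lsmul ℝ ℝ) hgloc hφ.continuous x
  have hlapl : ∀ x ∈ closedBall y r, lam ≤ lapl n F x := by
    intro x hx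
    set ψ : EuclideanSpace ℝ (Fin n) → ℝ := fun t => φ (x - t) with hψ
    have hψt : tsupport ψ ⊆ closedBall y ρ := by
      have h1 : tsupport ψ ⊆ closedBall x (ρ - r) := by
        refine closure_minimal (fun t ht => ?_) isClosed_closedBall
        have h2 : x - t ∈ tsupport φ := subset_tsupport φ ht
        rw [hφt, mem_closedBall_zero_iff] at h2
        rwa [mem_closedBall, dist_comm, dist_eq_norm]
      refine h1.trans (closedBall_subset_closedBall' ?_)
      have := mem_closedBall.mp hx
      linarith
    have hψc : HasCompactSupport ψ := (isCompact_closedBall y ρ).of_isClosed_subset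
      (isClosed_tsupport ψ) hψt
    have h1 := hw ψ (hφ.comp (contDiff_const.sub contDiff_id)) hψc (hψt.trans hV)
      (fun t => hφ0 _)
    rw [setIntegral_eq_integral_of_forall_compl_eq_zero
        (fun t ht => image_eq_zero_of_notMem_tsupport fun h => ht (hV (hψt h))), hφ1,
      setIntegral_eq_integral_of_forall_compl_eq_zero
        (fun t ht => by
          rw [lapl_eq_zero_of_notMem_tsupport fun h => ht (hV (hψt h)), mul_zero])] at h1
    rw [hF, lapl_convolution hgloc hφ hφc]
    calc lam = lam * 1 := (mul_one _).symm
      _ ≤ _ := h1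
      _ = _ := by
        refine integral_congr_ae (Filter.Eventually.of_forall fun t => ?_)
        show w t * lapl n ψ t = g t * lapl n φ (x - t)
        rw [← lapl_comp_const_sub]
        by_cases ht : t ∈ closedBall y ρ
        · rw [hg, indicator_of_mem ht]
        · rw [lapl_eq_zero_of_notMem_tsupport fun h => ht (hψt h)]; simp
  have hvcont : Continuous fun z => F z - a * ‖z - y‖ ^ 2 := by
    have := hFsmooth.continuous
    fun_prop
  obtain ⟨x, hx, hmax⟩ := (isCompact_closedBall y r).exists_isMaxOn
    ⟨y, mem_closedBall_self hr0.le⟩ hvcont.continuousOn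
  have hxr : dist x y < r := by
    refine lt_of_le_of_ne (mem_closedBall.mp hx) fun heq => ?_
    have h1 := hmax (mem_closedBall_self hr0.le)
    simp only [mem_ofPred_eq, ← dist_eq_norm, heq] at h1
    have := hFle x
    have := hFge y
    norm_num at h1
    linarith
  have hloc : IsLocalMax (fun z => F z - a * ‖z - y‖ ^ 2) x :=
    hmax.isLocalMax (closedBall_mem_nhds_of_mem (mem_ball.mpr hxr))
  have := lapl_le_of_isLocalMax hFsmooth a x y hloc
  have := hlapl x hx
  linarith

lemma mem_bulkSet {n : ℕ} {L : ℝ} {Λ : Set (EuclideanSpace ℝ (Fin n))}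
    {x : EuclideanSpace ℝ (Fin n)} :
    x ∈ bulkSet n L Λ ↔ ∃ k, (latticeCube n L k ∩ Λ).Nonempty ∧ x ∈ latticeCube n L k := by
  simp [bulkSet]

lemma dist_le_of_mem_latticeCube {n : ℕ} {L : ℝ} {k : Fin n → ℤ}
    {x z : EuclideanSpace ℝ (Fin n)} (hL : 0 ≤ L) (hx : x ∈ latticeCube n L k)
    (hz : z ∈ latticeCube n L k) : dist x z ≤ n * L := by
  rw [EuclideanSpace.dist_eq]
  refine Real.sqrt_le_iff.mpr ⟨by positivity, ?_⟩
  calc ∑ i, dist (x i) (z i) ^ 2 ≤ ∑ _i : Fin n, L ^ 2 := by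
        refine Finset.sum_le_sum fun i _ => ?_
        rw [Real.dist_eq, sq_abs]
        have h1 := hx i
        have h2 := hz i
        exact sq_le_sq' (by linarith) (by linarith)
    _ = n * L ^ 2 := by simp
    _ ≤ (n * L) ^ 2 := by
        rw [mul_pow]
        refine mul_le_mul_of_nonneg_right ?_ (by positivity)
        exact_mod_cast Nat.le_self_pow two_ne_zero n

lemma exists_closedBall_subset_latticeCube (n : ℕ) (L : ℝ) (k : Fin n → ℤ) :
    ∃ c, closedBall c (L / 2) ⊆ latticeCube n L k := by
  refine ⟨WithLp.toLp 2 fun i => L * k i + L / 2, fun x hx i => ?_⟩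
  have h1 : |x i - (L * k i + L / 2)| ≤ L / 2 := by
    refine le_trans ?_ (mem_closedBall.mp hx)
    rw [dist_eq_norm, ← Real.norm_eq_abs]
    exact PiLp.norm_apply_le (x - WithLp.toLp 2 fun i => L * k i + L / 2) i
  rw [abs_le] at h1
  constructor <;> linarith [h1.1, h1.2]

lemma exists_mem_latticeCube {n : ℕ} {L : ℝ} (hL : 0 < L) (x : EuclideanSpace ℝ (Fin n)) :
    ∃ k, x ∈ latticeCube n L k := by
  refine ⟨fun i => ⌊x i / L⌋, fun i => ⟨?_, ?_⟩⟩
  · have := Int.floor_le (x i / L)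
    rw [le_div_iff₀ hL] at this
    linarith
  · have := (Int.lt_floor_add_one (x i / L)).le
    rw [div_le_iff₀ hL] at this
    linarith

lemma IsPreconnected.inter_frontier_nonempty {X : Type*} [TopologicalSpace X] {s t : Set X}
    (ht : IsPreconnected t) (h1 : (t ∩ s).Nonempty) (h2 : (t ∩ sᶜ).Nonempty) :
    (t ∩ frontier s).Nonempty := by
  by_contra hcon
  rw [not_nonempty_iff_eq_empty] at hcon
  have hnot : ∀ x ∈ t, x ∉ frontier s := fun x hx hf => by
    have : x ∈ t ∩ frontier s := ⟨hx, hf⟩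
    simp [hcon] at this
  have hs : ∀ x ∈ t, x ∈ s → x ∈ interior s := fun x hx hxs => by
    by_contra h
    exact hnot x hx ⟨subset_closure hxs, h⟩
  have hsc : ∀ x ∈ t, x ∉ s → x ∈ (closure s)ᶜ := fun x hx hxs h =>
    hnot x hx ⟨h, fun h' => hxs (interior_subset h')⟩
  obtain ⟨p, hpt, hps⟩ := h1
  obtain ⟨q, hqt, hqs⟩ := h2
  obtain ⟨z, -, hz1, hz2⟩ := ht (interior s) (closure s)ᶜ isOpen_interior isClosed_closure.isOpen_compl
    (fun x hx => by
      by_cases h : x ∈ s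
      · exact Or.inl (hs x hx h)
      · exact Or.inr (hsc x hx h)) ⟨p, hpt, hs p hpt hps⟩ ⟨q, hqt, hsc q hqt hqs⟩
  exact hz2 (interior_subset_closure hz1)

lemma infDist_le_of_forall {X : Type*} [PseudoMetricSpace X] {x : X} {t : Set X} {r : ℝ}
    (hr : 0 ≤ r) (h : t.Nonempty → ∃ y ∈ t, dist x y ≤ r) : infDist x t ≤ r := by
  rcases t.eq_empty_or_nonempty with rfl | ht
  · simpa using hr
  · obtain ⟨y, hy, hxy⟩ := h ht
    exact (infDist_le_dist_of_mem hy).trans hxy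

/-- **Main theorem (Theorem 1.3).**  Under the sandwich estimate `w₀ - σ² ≤ w_ε ≤ w₀`
and the regularity properties (i)–(iii) of the unperturbed height function `w₀`
(strong non-degeneracy, non-degeneracy, positive density of the contact set, and the
`C^{1,1}`-type gradient bound), the Hausdorff distances between the contact set
`Λ₀ = {w₀ = 0}` and the bulk contact set `Λ̃_ε`, and between the free boundary
`Γ₀ = ∂Λ₀ ∩ U` and the bulk free boundary `Γ̃_ε = ∂Λ̃_ε ∩ U` (with cube side
`L = 4(2n/λ)^{1/2}σ`), are at most `Cσ`, where `C` depends only on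
`n, λ, c₀, c₁, c₂, M, δ` and `diam U`. -/
theorem main_hausdorff_estimate (n : ℕ) (lam c₀ c₁ c₂ M δ D : ℝ)
    (hlam : lam ∈ Set.Ioc (0:ℝ) 1) (hc₀ : 0 < c₀) (hc₁ : 0 < c₁)
    (hc₂ : c₂ ∈ Set.Ioo (0:ℝ) (1/2)) (hM : 0 < M) (hδ : 0 < δ) (hD : 0 < D) :
    ∃ C ≥ 1, ∀ U : Set (EuclideanSpace ℝ (Fin n)), IsOpen U → IsBounded U →
      Metric.diam U ≤ D →
      ∀ σ ∈ Set.Ioc (0:ℝ) 1,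
      ∀ Λε : Set (EuclideanSpace ℝ (Fin n)), Λε ⊆ U → closure Λε ∩ U ⊆ Λε →
        (∀ x ∈ Λε, ∀ y ∈ frontier U, δ ≤ dist x y) →
      ∀ wε : EuclideanSpace ℝ (Fin n) → ℝ, ContinuousOn wε U →
        (∀ x ∈ U, -σ ^ 2 ≤ wε x) → (∀ x ∈ Λε, wε x ≤ 0) →
        LapGeWeak n (U \ Λε) wε lam →
      ∀ w₀ : EuclideanSpace ℝ (Fin n) → ℝ, ContinuousOn w₀ U →
        (∀ x ∈ U, 0 ≤ w₀ x) →
        {y ∈ U | w₀ y = 0}.Nonempty →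
        (∀ x ∈ {y ∈ U | w₀ y = 0}, ∀ y ∈ frontier U, δ ≤ dist x y) →
        (∀ x ∈ U, w₀ x - σ ^ 2 ≤ wε x ∧ wε x ≤ w₀ x) →
        (∀ x ∈ U, 0 < w₀ x →
          c₁ * Metric.infDist x (frontier {y ∈ U | w₀ y = 0} ∩ U) ^ 2 ≤ w₀ x) →
        (∀ x ∈ frontier {y ∈ U | w₀ y = 0} ∩ U, ∀ r : ℝ, 0 < r →
          closedBall x r ⊆ U → c₀ * r ^ 2 ≤ sSup (w₀ '' ball x r)) →
        (∀ x ∈ {y ∈ U | w₀ y = 0}, ∀ r : ℝ, 0 < r → ball x r ⊆ U →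
          ∃ y ∈ {y ∈ U | w₀ y = 0} ∩ ball x r,
            closedBall y (c₂ * r) ⊆ {y ∈ U | w₀ y = 0} ∩ ball x r) →
        DifferentiableOn ℝ w₀ U →
        (∀ y ∈ U, ‖gradient w₀ y‖ ≤ M * Metric.infDist y {y ∈ U | w₀ y = 0}) →
        Metric.hausdorffDist {y ∈ U | w₀ y = 0}
            (bulkSet n (4 * Real.sqrt (2 * n / lam) * σ) Λε) ≤ C * σ ∧
        Metric.hausdorffDist (frontier {y ∈ U | w₀ y = 0} ∩ U)
            (frontier (bulkSet n (4 * Real.sqrt (2 * n / lam) * σ) Λε) ∩ U) ≤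
          C * σ := by
  rcases Nat.eq_zero_or_pos n with rfl | hn
  · refine ⟨1, le_rfl, ?_⟩
    intro U _ _ _ σ hσ Λε _ _ _ wε _ _ _ _ w₀ _ _ _ _ _ _ _ _ _ _
    have hσ0 : 0 ≤ 1 * σ := by linarith [hσ.1]
    have key : ∀ s t : Set (EuclideanSpace ℝ (Fin 0)), hausdorffDist s t ≤ 1 * σ := by
      intro s t
      have h : ∀ (x : EuclideanSpace ℝ (Fin 0)) (u : Set (EuclideanSpace ℝ (Fin 0))),
          infDist x u ≤ 1 * σ := fun x u =>
        infDist_le_of_forall hσ0 fun ⟨y, hy⟩ => ⟨y, hy, by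
          rw [Subsingleton.elim x y, dist_self]; exact hσ0⟩
      exact hausdorffDist_le_of_infDist hσ0 (fun x _ => h x t) (fun x _ => h x s)
    exact ⟨key _ _, key _ _⟩
  obtain ⟨hlam0, -⟩ := hlam
  obtain ⟨hc₂0, -⟩ := hc₂
  have hn' : (0 : ℝ) < n := by exact_mod_cast hn
  set κ : ℝ := Real.sqrt (2 * n / lam) with hκ
  have hκ0 : 0 < κ := Real.sqrt_pos.mpr (by positivity)
  have hκ2 : lam * κ ^ 2 = 2 * n := by
    rw [hκ, Real.sq_sqrt (by positivity)]; field_simp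
  obtain ⟨A₁, hA₁⟩ : ∃ A, A = n * (4 * κ) + (1 / Real.sqrt c₁ + 1) := ⟨_, rfl⟩
  obtain ⟨A₂, hA₂⟩ : ∃ A, A = 2 * κ / c₂ := ⟨_, rfl⟩
  obtain ⟨A₃, hA₃⟩ : ∃ A, A = A₁ * (Real.sqrt (M / c₀) + 1) := ⟨_, rfl⟩
  obtain ⟨A₅, hA₅⟩ : ∃ A, A = 4 * κ + n * (4 * κ) := ⟨_, rfl⟩
  have hc₁s : 0 < Real.sqrt c₁ := Real.sqrt_pos.mpr hc₁
  have hA₁1 : 1 ≤ A₁ := by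
    have : 0 ≤ n * (4 * κ) + 1 / Real.sqrt c₁ := by positivity
    linarith
  have hA₂0 : 0 < A₂ := by rw [hA₂]; positivity
  have hA₃0 : 0 < A₃ := by rw [hA₃]; positivity
  have hA₅0 : 0 < A₅ := by rw [hA₅]; positivity
  have hA₃2 : M * A₁ ^ 2 < c₀ * A₃ ^ 2 := by
    have h1 : Real.sqrt (M / c₀) ^ 2 = M / c₀ := Real.sq_sqrt (by positivity)
    have h2 : 0 ≤ Real.sqrt (M / c₀) := Real.sqrt_nonneg _
    have h3 : M = c₀ * Real.sqrt (M / c₀) ^ 2 := by rw [h1]; field_simp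
    have h4 : 0 < c₀ * A₁ ^ 2 * (2 * Real.sqrt (M / c₀) + 1) := by positivity
    calc M * A₁ ^ 2 = c₀ * Real.sqrt (M / c₀) ^ 2 * A₁ ^ 2 := by rw [← h3]
      _ < c₀ * Real.sqrt (M / c₀) ^ 2 * A₁ ^ 2 +
          c₀ * A₁ ^ 2 * (2 * Real.sqrt (M / c₀) + 1) := by linarith
      _ = c₀ * A₃ ^ 2 := by rw [hA₃]; ring
  obtain ⟨A₄, hA₄⟩ : ∃ A, A = A₁ + A₂ + A₃ := ⟨_, rfl⟩
  have hA₄0 : 0 < A₄ := by linarith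
  have hDA : 0 < D * A₄ / δ := by positivity
  refine ⟨1 + A₄ + A₅ + D * A₄ / δ, by linarith, ?_⟩
  intro U hUo hUb hUD σ hσ Λε hΛU _ _ wε hwεc hwεlow hwεle hwεΔ w₀ hw₀c hw₀0 hne hdist hsand
    hsnd hnd hpd hdiff hgrad
  obtain ⟨hσ0, -⟩ := hσ
  set Λ₀ : Set (EuclideanSpace ℝ (Fin n)) := {y ∈ U | w₀ y = 0} with hΛ₀
  obtain ⟨L, hL⟩ : ∃ L, L = 4 * κ * σ := ⟨_, rfl⟩
  rw [← hL]
  have hL0 : 0 < L := by rw [hL]; positivity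
  obtain ⟨C, hC⟩ : ∃ C, C = 1 + A₄ + A₅ + D * A₄ / δ := ⟨_, rfl⟩
  rw [← hC]
  have hCle : ∀ A, A ≤ 1 + A₄ + A₅ + D * A₄ / δ → A * σ ≤ C * σ := fun A hA => by
    rw [hC]; exact mul_le_mul_of_nonneg_right hA hσ0.le
  have hC0 : 0 ≤ C * σ := by rw [hC]; positivity
  have hdistU : ∀ x ∈ U, ∀ y ∈ U, dist x y ≤ D := fun x hx y hy =>
    (dist_le_diam_of_mem hUb hx hy).trans hUD
  have hlarge : ¬ A₄ * σ < δ → D ≤ C * σ := by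
    intro h
    push Not at h
    refine le_trans ?_ (hCle (D * A₄ / δ) (by linarith))
    rw [div_mul_eq_mul_div, le_div_iff₀ hδ]
    have := mul_le_mul_of_nonneg_left h hD.le
    linarith
  -- the contact set is compactly contained in `U`
  have hballU : ∀ x ∈ Λ₀, ball x δ ⊆ U := by
    intro x hx z hz
    by_contra hzU
    obtain ⟨f, hf1, hf2⟩ := (convex_ball x δ).isPreconnected.inter_frontier_nonempty
      ⟨x, mem_ball_self hδ, hx.1⟩ ⟨z, hz, hzU⟩
    have := hdist x hx f hf2
    rw [mem_ball, dist_comm] at hf1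
    linarith
  have hclosedBallU : ∀ x ∈ Λ₀, ∀ r < δ, closedBall x r ⊆ U := fun x hx r hr =>
    (closedBall_subset_ball hr).trans (hballU x hx)
  have hclU : closure Λ₀ ⊆ U := by
    intro x hx
    obtain ⟨y, hy, hxy⟩ := Metric.mem_closure_iff.mp hx δ hδ
    exact hballU y hy hxy
  have hΛ₀closed : IsClosed Λ₀ := by
    refine isClosed_of_closure_subset fun x hx => ⟨hclU hx, ?_⟩
    have h1 : w₀ x ∈ closure (w₀ '' Λ₀) :=
      ((hw₀c.continuousAt (hUo.mem_nhds (hclU hx))).continuousWithinAt).mem_closure_image hx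
    have h2 : w₀ '' Λ₀ ⊆ {0} := by rintro _ ⟨z, hz, rfl⟩; exact hz.2
    simpa using closure_mono h2 h1
  have hfrΛ₀ : frontier Λ₀ ⊆ Λ₀ := hΛ₀closed.frontier_subset
  have hfrU : frontier Λ₀ ∩ U = frontier Λ₀ :=
    inter_eq_left.mpr (hfrΛ₀.trans fun x hx => hx.1)
  have hfrne : (frontier Λ₀).Nonempty := by
    have : Nonempty (Fin n) := ⟨⟨0, hn⟩⟩
    rw [nonempty_frontier_iff]
    refine ⟨hne, fun h => ?_⟩
    have h1 : IsBounded Λ₀ := hUb.subset fun x hx => hx.1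
    rw [h] at h1
    exact NormedSpace.unbounded_univ ℝ (EuclideanSpace ℝ (Fin n)) h1
  rw [hfrU] at hsnd hnd ⊢
  -- points of `Λε` and of the bulk set are close to `Λ₀`
  have hΛεnear : ∀ x ∈ Λε, ∃ p ∈ Λ₀, dist x p ≤ (1 / Real.sqrt c₁ + 1) * σ := by
    intro x hx
    have hxU := hΛU hx
    rcases (hw₀0 x hxU).eq_or_lt with h0 | h0
    · exact ⟨x, ⟨hxU, h0.symm⟩, by rw [dist_self]; positivity⟩
    · have h1 := hsnd x hxU h0
      have h2 : w₀ x ≤ σ ^ 2 := by linarith [(hsand x hxU).1, hwεle x hx]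
      have h3 : infDist x (frontier Λ₀) < (1 / Real.sqrt c₁ + 1) * σ := by
        have h4 : (Real.sqrt c₁ * infDist x (frontier Λ₀)) ^ 2 ≤ σ ^ 2 := by
          rw [mul_pow, Real.sq_sqrt hc₁.le]; linarith
        have h5 := le_of_sq_le_sq h4 hσ0.le
        have h6 : infDist x (frontier Λ₀) ≤ 1 / Real.sqrt c₁ * σ := by
          rw [div_mul_eq_mul_div, le_div_iff₀ hc₁s]; linarith
        linarith
      obtain ⟨p, hp, hxp⟩ := (infDist_lt_iff hfrne).mp h3
      exact ⟨p, hfrΛ₀ hp, hxp.le⟩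
  have hbulknear : ∀ z ∈ bulkSet n L Λε, ∃ p ∈ Λ₀, dist z p ≤ A₁ * σ := by
    intro z hz
    obtain ⟨k, ⟨x, hxk, hx⟩, hzk⟩ := mem_bulkSet.mp hz
    obtain ⟨p, hp, hxp⟩ := hΛεnear x hx
    refine ⟨p, hp, ?_⟩
    have h1 := dist_le_of_mem_latticeCube hL0.le hzk hxk
    calc dist z p ≤ dist z x + dist x p := dist_triangle _ _ _
      _ ≤ n * L + (1 / Real.sqrt c₁ + 1) * σ := add_le_add h1 hxp
      _ = A₁ * σ := by rw [hA₁, hL]; ring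
  -- balls contained in `Λ₀` of the relevant radius meet `Λε`
  have hmeet : ∀ y, closedBall y (2 * κ * σ) ⊆ Λ₀ → ∃ p ∈ Λε, p ∈ closedBall y (2 * κ * σ) := by
    intro y hy
    by_contra hcon
    push Not at hcon
    have hyU : closedBall y (2 * κ * σ) ⊆ U := fun x hx => (hy hx).1
    have h1 := hwεΔ.mul_sq_radius_le hn (y := y) (ρ := 2 * κ * σ) (s := σ ^ 2) (by positivity)
      (fun x hx => ⟨hyU hx, fun hxΛ => hcon x hxΛ hx⟩) (hwεc.mono hyU)
      (fun x hx => hwεlow x (hyU hx))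
      (fun x hx => by have := (hsand x (hyU hx)).2; rwa [(hy hx).2] at this)
    have h2 : lam * (2 * κ * σ) ^ 2 = 4 * σ ^ 2 * (2 * n) := by rw [← hκ2]; ring
    rw [h2] at h1
    have : 0 < n * σ ^ 2 := by positivity
    linarith
  have hΛεbulk : Λε ⊆ bulkSet n L Λε := by
    intro x hx
    obtain ⟨k, hk⟩ := exists_mem_latticeCube hL0 x
    exact mem_bulkSet.mpr ⟨k, ⟨x, hk, hx⟩, hk⟩
  have hΛ₀near : ∀ x ∈ Λ₀, A₄ * σ < δ → ∃ p ∈ Λε, dist x p ≤ A₂ * σ := by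
    intro x hx hsmall
    have hA₂σ : A₂ * σ < δ :=
      lt_of_le_of_lt (mul_le_mul_of_nonneg_right (by linarith) hσ0.le) hsmall
    obtain ⟨y, -, hy⟩ := hpd x hx (A₂ * σ) (by positivity)
      ((ball_subset_ball hA₂σ.le).trans (hballU x hx))
    have h1 : c₂ * (A₂ * σ) = 2 * κ * σ := by rw [hA₂]; field_simp
    rw [h1] at hy
    obtain ⟨p, hp, hpy⟩ := hmeet y (hy.trans inter_subset_left)
    refine ⟨p, hp, ?_⟩
    rw [dist_comm]
    exact (mem_ball.mp (hy hpy).2).le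
  -- quadratic growth of `w₀` away from `Λ₀`
  have hgrowth : ∀ p ∈ Λ₀, ∀ z, ∀ d < δ, dist z p ≤ d → w₀ z ≤ M * d ^ 2 := by
    intro p hp z d hd hzp
    have hd0 : 0 ≤ d := dist_nonneg.trans hzp
    have hsub := hclosedBallU p hp d hd
    have h1 := (convex_closedBall p d).norm_image_sub_le_of_norm_fderiv_le (𝕜 := ℝ) (f := w₀)
      (C := M * d) (x := p) (y := z)
      (fun y hy => hdiff.differentiableAt (hUo.mem_nhds (hsub hy)))
      (fun y hy => by
        have h2 := hgrad y (hsub hy)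
        have h3 : ‖gradient w₀ y‖ = ‖fderiv ℝ w₀ y‖ := by
          unfold gradient; exact LinearIsometryEquiv.norm_map _ _
        rw [← h3]
        exact h2.trans (mul_le_mul_of_nonneg_left
          ((infDist_le_dist_of_mem hp).trans (mem_closedBall.mp hy)) hM.le))
      (mem_closedBall_self hd0) (mem_closedBall.mpr hzp)
    rw [hp.2, sub_zero, ← dist_eq_norm] at h1
    have h4 : M * d * dist z p ≤ M * d * d := mul_le_mul_of_nonneg_left hzp (by positivity)
    calc w₀ z ≤ ‖w₀ z‖ := Real.le_norm_self _
      _ ≤ M * d * d := h1.trans h4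
      _ = M * d ^ 2 := by ring
  refine ⟨hausdorffDist_le_of_infDist hC0 ?_ ?_, hausdorffDist_le_of_infDist hC0 ?_ ?_⟩
  · intro x hx
    refine infDist_le_of_forall hC0 fun hb => ?_
    by_cases hsmall : A₄ * σ < δ
    · obtain ⟨p, hp, hxp⟩ := hΛ₀near x hx hsmall
      exact ⟨p, hΛεbulk hp, hxp.trans (hCle _ (by linarith))⟩
    · obtain ⟨q, hq⟩ := hb
      obtain ⟨k, ⟨p, -, hp⟩, -⟩ := mem_bulkSet.mp hq
      exact ⟨p, hΛεbulk hp, (hdistU x hx.1 p (hΛU hp)).trans (hlarge hsmall)⟩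
  · intro z hz
    obtain ⟨p, hp, hzp⟩ := hbulknear z hz
    exact (infDist_le_dist_of_mem hp).trans (hzp.trans (hCle _ (by linarith)))
  · intro x hx
    have hxΛ := hfrΛ₀ hx
    refine infDist_le_of_forall hC0 fun hb => ?_
    by_cases hsmall : A₄ * σ < δ
    · have hle : ∀ A, A ≤ A₄ → A * σ ≤ A₄ * σ := fun A hA =>
        mul_le_mul_of_nonneg_right hA hσ0.le
      have hsub := hclosedBallU x hxΛ _ hsmall
      obtain ⟨q, hq, hxq⟩ := hΛ₀near x hxΛ hsmall
      have h1 := hnd x hx (A₃ * σ) (by positivity)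
        ((closedBall_subset_closedBall (hle A₃ (by linarith))).trans hsub)
      obtain ⟨_, ⟨z, hz, rfl⟩, hzlt⟩ := exists_lt_of_lt_csSup
        (b := M * (A₁ * σ) ^ 2) ((nonempty_ball.mpr (by positivity : 0 < A₃ * σ)).image w₀)
        (lt_of_lt_of_le (by
          have := mul_lt_mul_of_pos_right hA₃2 (by positivity : 0 < σ ^ 2)
          calc M * (A₁ * σ) ^ 2 = M * A₁ ^ 2 * σ ^ 2 := by ring
            _ < _ := this
            _ = _ := by ring) h1)
      have hznot : z ∉ bulkSet n L Λε := fun hzb => by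
        obtain ⟨p, hp, hzp⟩ := hbulknear z hzb
        have := hgrowth p hp z (A₁ * σ) ((hle A₁ (by linarith)).trans_lt hsmall) hzp
        linarith
      obtain ⟨f, hf1, hf2⟩ :=
        (convex_closedBall x (A₄ * σ)).isPreconnected.inter_frontier_nonempty
          ⟨q, by
            rw [mem_closedBall, dist_comm]; exact hxq.trans (hle A₂ (by linarith)),
            hΛεbulk hq⟩
          ⟨z, ball_subset_closedBall (ball_subset_ball (hle A₃ (by linarith)) hz), hznot⟩
      refine ⟨f, ⟨hf2, hsub hf1⟩, ?_⟩
      rw [mem_closedBall, dist_comm] at hf1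
      exact hf1.trans (hCle _ (by linarith))
    · obtain ⟨f, hf, hfU⟩ := hb
      exact ⟨f, ⟨hf, hfU⟩, (hdistU x hxΛ.1 f hfU).trans (hlarge hsmall)⟩
  · rintro x ⟨hx, hxU⟩
    refine infDist_le_of_forall hC0 fun _ => ?_
    by_cases hxΛ : x ∈ Λ₀
    · have hnsub : ¬ closedBall x (A₅ * σ) ⊆ Λ₀ := by
        intro hsub
        refine hx.2 (mem_interior.mpr ⟨ball x L, fun z hz => ?_, isOpen_ball, mem_ball_self hL0⟩)
        obtain ⟨k, hk⟩ := exists_mem_latticeCube hL0 z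
        obtain ⟨c, hc⟩ := exists_closedBall_subset_latticeCube n L k
        have hL2 : L / 2 = 2 * κ * σ := by rw [hL]; ring
        rw [hL2] at hc
        obtain ⟨p, hp, hpc⟩ := hmeet c fun y hy => hsub (by
          have h1 := dist_le_of_mem_latticeCube hL0.le (hc hy) hk
          have h2 := (mem_ball.mp hz).le
          calc dist y x ≤ dist y z + dist z x := dist_triangle _ _ _
            _ ≤ n * L + L := add_le_add h1 h2
            _ = A₅ * σ := by rw [hA₅, hL]; ring)
        exact mem_bulkSet.mpr ⟨k, ⟨p, hc hpc, hp⟩, hk⟩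
      obtain ⟨z, hz, hzΛ⟩ := not_subset.mp hnsub
      obtain ⟨f, hf1, hf2⟩ :=
        (convex_closedBall x (A₅ * σ)).isPreconnected.inter_frontier_nonempty
          ⟨x, mem_closedBall_self (by positivity), hxΛ⟩ ⟨z, hz, hzΛ⟩
      refine ⟨f, hf2, ?_⟩
      rw [mem_closedBall, dist_comm] at hf1
      exact hf1.trans (hCle _ (by linarith))
    · obtain ⟨z, hz, hxz⟩ := Metric.mem_closure_iff.mp hx.1 σ hσ0
      obtain ⟨p, hp, hzp⟩ := hbulknear z hz
      have hxp : dist x p ≤ (A₁ + 1) * σ := by linarith [dist_triangle x z p]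
      obtain ⟨f, hf1, hf2⟩ :=
        (convex_closedBall x ((A₁ + 1) * σ)).isPreconnected.inter_frontier_nonempty
          ⟨p, by rwa [mem_closedBall, dist_comm], hp⟩
          ⟨x, mem_closedBall_self (by positivity), hxΛ⟩
      refine ⟨f, hf2, ?_⟩
      rw [mem_closedBall, dist_comm] at hf1
      exact hf1.trans (hCle _ (by linarith))
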